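/- Let g ∈ ℚ[x] be x²-divisible, let a be a nonzero integer, and set h(x) := (1/a)·g(ax). Then for every c ∈ ℚ for which both Zsigmondy sets Z(g_c, 0) and Z(h_{c/a}, 0) are finite, one has |#Z(g_c, 0) − #Z(h_{c/a}, 0)| ≤ ω(a), where ω(a) is the number of distinct prime divisors of a. -/

import Mathlib

open Polynomial

/-- The `n`-th iterate of `g_c := g + c` applied to `0`, for `g ∈ ℚ[x]`. -/
noncomputable def gcIterQ (g : ℚ[X]) (c : ℚ) (n : ℕ) : ℚ :=
  (fun x : ℚ => g.eval x + c)^[n] 0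

/-- `g` is `x²`-divisible: degree at least 2 and zero constant and linear coefficients. -/
def IsX2DivisibleQ (g : ℚ[X]) : Prop :=
  2 ≤ g.natDegree ∧ g.coeff 0 = 0 ∧ g.coeff 1 = 0

/-- A prime `p` is a primitive prime divisor of `g_c^n(0)` if `val_p(g_c^n(0)) > 0`
and `val_p(g_c^k(0)) ≤ 0` for all `1 ≤ k < n`. -/
def HasPrimitivePrimeDivisor (g : ℚ[X]) (c : ℚ) (n : ℕ) : Prop :=
  ∃ p : ℕ, p.Prime ∧ 0 < padicValRat p (gcIterQ g c n) ∧
    ∀ k : ℕ, 1 ≤ k → k < n → padicValRat p (gcIterQ g c k) ≤ 0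

/-- The Zsigmondy set `Z(g_c, 0)` of the sequence `{g_c^n(0)}_{n ≥ 1}`. -/
def Zsig (g : ℚ[X]) (c : ℚ) : Set ℕ :=
  {n : ℕ | 1 ≤ n ∧ ¬ HasPrimitivePrimeDivisor g c n}

/-- Rescaling `x` by `a` divides the critical orbit by `a`. -/
lemma gcIterQ_rescale (g : ℚ[X]) {a : ℚ} (ha : a ≠ 0) (c : ℚ) (n : ℕ) :
    gcIterQ (C a⁻¹ * g.comp (C a * X)) (c / a) n = gcIterQ g c n / a := by
  have key : Function.Semiconj (fun x : ℚ => x / a) (fun x => g.eval x + c)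
      (fun x => (C a⁻¹ * g.comp (C a * X)).eval x + c / a) := by
    intro x
    simp [div_eq_inv_mul, ha, mul_add]
  simpa [gcIterQ] using ((key.iterate_right n).eq 0).symm

/-- Dividing by an integer prime to `p` does not change the `p`-adic valuation. -/
lemma padicValRat_div_intCast_of_not_dvd {p : ℕ} (hp : p.Prime) {a : ℤ} (ha : a ≠ 0)
    (hpa : ¬ p ∣ a.natAbs) (x : ℚ) : padicValRat p (x / a) = padicValRat p x := by
  have : Fact p.Prime := ⟨hp⟩
  rcases eq_or_ne x 0 with rfl | hx
  · simp
  · rw [padicValRat.div hx (by exact_mod_cast ha), padicValRat.of_int,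
      padicValInt.eq_zero_of_not_dvd (by rwa [Int.natCast_dvd])]
    simp

/-- If two critical orbits have the same valuations at all primes outside a finite set `S`, then
the sizes of their Zsigmondy sets compare up to the size of `S`. -/
lemma ncard_Zsig_le_of_padicValRat_eq {g h : ℚ[X]} {c d : ℚ} {S : Finset ℕ}
    (hval : ∀ p : ℕ, p.Prime → p ∉ S → ∀ n,
      padicValRat p (gcIterQ g c n) = padicValRat p (gcIterQ h d n))
    (hfin : (Zsig h d).Finite) :
    (Zsig g c).ncard ≤ (Zsig h d).ncard + S.card := by
  have hex : ∀ n ∈ Zsig g c \ Zsig h d, ∃ p ∈ S, 0 < padicValRat p (gcIterQ h d n) ∧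
      ∀ k, 1 ≤ k → k < n → padicValRat p (gcIterQ h d k) ≤ 0 := by
    rintro n ⟨⟨hn, hng⟩, hnh⟩
    obtain ⟨p, hp, hpos, hle⟩ : HasPrimitivePrimeDivisor h d n := by
      by_contra hc
      exact hnh ⟨hn, hc⟩
    refine ⟨p, ?_, hpos, hle⟩
    by_contra hpS
    refine hng ⟨p, hp, ?_, fun k hk hkn => ?_⟩
    · rwa [hval p hp hpS]
    · rw [hval p hp hpS]
      exact hle k hk hkn
  choose! f hfS hpos hle using hex
  have hdiff : (Zsig g c \ Zsig h d).ncard ≤ (S : Set ℕ).ncard := by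
    refine Set.ncard_le_ncard_of_injOn f hfS ?_ S.finite_toSet
    intro m hm n hn hmn
    rcases lt_trichotomy m n with hlt | heq | hgt
    · exact absurd (hpos m hm) (not_lt.mpr (hmn ▸ hle n hn m hm.1.1 hlt))
    · exact heq
    · exact absurd (hpos n hn) (not_lt.mpr (hmn ▸ hle m hm n hn.1.1 hgt))
  have := Set.ncard_le_ncard_sdiff_add_ncard (Zsig g c) (Zsig h d) hfin
  rw [Set.ncard_coe_finset] at hdiff
  omega

/-- Lemma 4.2: for `g ∈ ℚ[x]` `x²`-divisible, a nonzero integer `a`, and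
`h(x) = (1/a) g(a x)`, for every `c ∈ ℚ` (with both Zsigmondy sets finite) one has
`|#Z(g_c, 0) − #Z(h_{c/a}, 0)| ≤ ω(a)`. -/
theorem zsigmondy_card_diff_le_omega (g : ℚ[X]) (hg : IsX2DivisibleQ g)
    (a : ℤ) (ha : a ≠ 0) (c : ℚ)
    (h1 : (Zsig g c).Finite)
    (h2 : (Zsig (Polynomial.C ((a : ℚ))⁻¹ *
      g.comp (Polynomial.C (a : ℚ) * Polynomial.X)) (c / a)).Finite) :
    |((Zsig g c).ncard : ℤ) -
        ((Zsig (Polynomial.C ((a : ℚ))⁻¹ *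
          g.comp (Polynomial.C (a : ℚ) * Polynomial.X)) (c / a)).ncard : ℤ)| ≤
      a.natAbs.primeFactors.card := by
  have haq : (a : ℚ) ≠ 0 := by exact_mod_cast ha
  have hval : ∀ p : ℕ, p.Prime → p ∉ a.natAbs.primeFactors → ∀ n,
      padicValRat p (gcIterQ (C (a : ℚ)⁻¹ * g.comp (C (a : ℚ) * X)) (c / a) n) =
        padicValRat p (gcIterQ g c n) := by
    intro p hp hpa n
    rw [gcIterQ_rescale g haq]
    refine padicValRat_div_intCast_of_not_dvd hp ha (fun hdvd => hpa ?_) _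
    exact Nat.mem_primeFactors.mpr ⟨hp, hdvd, Int.natAbs_ne_zero.mpr ha⟩
  have hle := ncard_Zsig_le_of_padicValRat_eq hval h1
  have hge := ncard_Zsig_le_of_padicValRat_eq
    (fun p hp hpa n => (hval p hp hpa n).symm) h2
  rw [abs_le]
  constructor <;> omega
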